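/- arXiv:1906.05704 — 4 statements merged into one kernel-verified Lean document; each statement's English description precedes it below -/
import Mathlib

section
/- Lower barrier invariance: Let f : ℝ → ℝ be continuous, and let c be a real number with f 0 ≥ c. Suppose that for every t ≥ 0 with f t = c there exists k > 0 such that f has derivative k at t (HasDerivAt f k t). Then f t ≥ c for all t ≥ 0. -/
/-- Lower barrier invariance: if `f` is continuous, starts at or above `c`, and has a
strictly positive derivative whenever it touches `c` at a nonnegative time, then `f`
stays at or above `c` for all nonnegative times. -/
theorem lower_barrier_invariance (f : ℝ → ℝ) (c : ℝ)
    (hf : Continuous f) (h0 : f 0 ≥ c)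
    (hderiv : ∀ t ≥ (0 : ℝ), f t = c → ∃ k > (0 : ℝ), HasDerivAt f k t) :
    ∀ t ≥ (0 : ℝ), f t ≥ c := by
  intro t ht
  have hcl : IsClosed ({x | c ≤ f x} ∩ Set.Icc 0 t) :=
    (isClosed_le continuous_const hf).inter isClosed_Icc
  refine hcl.Icc_subset_of_forall_mem_nhdsWithin h0 ?_ ⟨ht, le_rfl⟩
  rintro x ⟨hx, hx0, -⟩
  rcases (show c ≤ f x from hx).lt_or_eq with h | h
  · exact mem_nhdsWithin_of_mem_nhds
      ((hf.continuousAt.eventually (lt_mem_nhds h)).mono fun y hy => le_of_lt hy)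
  · obtain ⟨k, hk, hd⟩ := hderiv x hx0 h.symm
    have hs := (hasDerivAt_iff_tendsto_slope.1 hd).eventually (lt_mem_nhds hk)
    have hs' := hs.filter_mono (nhdsWithin_mono x (fun y (hy : x < y) => ne_of_gt hy))
    filter_upwards [hs', self_mem_nhdsWithin] with y hy hxy
    have hxy : x < y := hxy
    rw [slope_def_field, div_pos_iff_of_pos_right (sub_pos.2 hxy)] at hy
    show c ≤ f y
    linarith
end

section
/- Upper barrier invariance: Let f : ℝ → ℝ be continuous, and let C be a real number with f 0 ≤ C. Suppose that for every t ≥ 0 with f t = C there exists k < 0 such that f has derivative k at t (HasDerivAt f k t). Then f t ≤ C for all t ≥ 0. -/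
/-- Upper barrier invariance: if `f` is continuous, starts at or below `C`, and has a
strictly negative derivative whenever it touches `C` at a nonnegative time, then `f`
stays at or below `C` for all nonnegative times. -/
theorem upper_barrier_invariance (f : ℝ → ℝ) (C : ℝ)
    (hf : Continuous f) (h0 : f 0 ≤ C)
    (hderiv : ∀ t ≥ (0 : ℝ), f t = C → ∃ k < (0 : ℝ), HasDerivAt f k t) :
    ∀ t ≥ (0 : ℝ), f t ≤ C := by
  intro T hT
  have hcl : IsClosed ({x | f x ≤ C} ∩ Set.Icc 0 T) :=
    (isClosed_le hf continuous_const).inter isClosed_Icc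
  refine hcl.Icc_subset_of_forall_mem_nhdsWithin h0 ?_ (Set.right_mem_Icc.2 hT)
  rintro x ⟨hx, hx0, -⟩
  rcases lt_or_eq_of_le (show f x ≤ C from hx) with h | h
  · have h1 : ∀ᶠ y in nhds x, f y < C := hf.continuousAt.eventually_lt_const h
    exact nhdsWithin_le_nhds (h1.mono fun y hy => le_of_lt hy)
  · obtain ⟨k, hk, hd⟩ := hderiv x hx0 h
    have h1 : ∀ᶠ y in nhdsWithin x (Set.Ioi x), slope f x y < 0 :=
      ((hasDerivAt_iff_tendsto_slope.1 hd).mono_left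
        (nhdsWithin_mono x fun y hy => ne_of_gt hy)).eventually_lt_const hk
    filter_upwards [h1, self_mem_nhdsWithin] with y hy hxy
    have hpos : 0 < y - x := sub_pos.2 hxy
    rw [slope_def_field, div_lt_iff₀ hpos, zero_mul] at hy
    show f y ≤ C
    linarith
end

section
/- Corridor invariance: Let f, g : ℝ → ℝ with f continuous, and suppose f has derivative g t at every t ≥ 0 (HasDerivAt f (g t) t). Let a < b be real numbers with a ≤ f 0 ≤ b. If for every t ≥ 0, f t = a implies g t > 0, and f t = b implies g t < 0, then a ≤ f t ≤ b for all t ≥ 0. -/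
/-- Corridor invariance: a trajectory whose derivative points strictly inward at both
boundaries of the corridor `[a, b]` remains in the corridor forever. -/
theorem corridor_invariance (f g : ℝ → ℝ)
    (hf : Continuous f)
    (hderiv : ∀ t ≥ (0 : ℝ), HasDerivAt f (g t) t)
    (a b : ℝ) (hab : a < b)
    (h0 : a ≤ f 0 ∧ f 0 ≤ b)
    (ha : ∀ t ≥ (0 : ℝ), f t = a → g t > 0)
    (hb : ∀ t ≥ (0 : ℝ), f t = b → g t < 0) :
    ∀ t ≥ (0 : ℝ), a ≤ f t ∧ f t ≤ b := by
  intro t ht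
  constructor
  · exact image_le_of_deriv_right_lt_deriv_boundary' (f := fun _ => a) (f' := fun _ => 0)
      (B := f) (B' := g) (a := 0) (b := t) continuousOn_const
      (fun x _ => hasDerivWithinAt_const x _ a) h0.1 hf.continuousOn
      (fun x hx => (hderiv x hx.1).hasDerivWithinAt)
      (fun x hx h => ha x hx.1 h.symm) ⟨ht, le_refl t⟩
  · exact image_le_of_deriv_right_lt_deriv_boundary' (f := f) (f' := g)
      (B := fun _ => b) (B' := fun _ => 0) (a := 0) (b := t) hf.continuousOn
      (fun x hx => (hderiv x hx.1).hasDerivWithinAt) h0.2 continuousOn_const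
      (fun x _ => hasDerivWithinAt_const x _ b)
      (fun x hx h => hb x hx.1 h) ⟨ht, le_refl t⟩
end

section
/- Safety of the sampled-data two-object water tank: Let s : ℕ → ℝ be strictly monotone with s 0 = 0, s (n+1) - s n < 1 for all n, and s n → ∞ as n → ∞. Let d : ℕ → ℝ and level : ℝ → ℝ satisfy, for every n and every t with s n ≤ t ≤ s (n+1), level t = level (s n) + d n · (t - s n). Assume for every n: -1/2 ≤ d n ≤ 1/2, d n < 0 implies level (s n) ≥ 7/2, and d n > 0 implies level (s n) ≤ 19/2. If 4 < level 0 < 9, then 3 ≤ level t ≤ 10 for all t ≥ 0. -/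
/-- Safety of the sampled-data two-object water tank: between samples the level evolves
linearly with a drain value satisfying the in-port precondition of `inDrain`, sampling
gaps are strictly less than 1, and the initial level is strictly between 4 and 9; then
the level always stays in `[3, 10]`. -/
theorem two_object_tank_safety (s : ℕ → ℝ)
    (hmono : StrictMono s) (hs0 : s 0 = 0)
    (hgap : ∀ n, s (n + 1) - s n < 1)
    (htend : Filter.Tendsto s Filter.atTop Filter.atTop)
    (d : ℕ → ℝ) (level : ℝ → ℝ)
    (hlin : ∀ n, ∀ t, s n ≤ t → t ≤ s (n + 1) →
      level t = level (s n) + d n * (t - s n))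
    (hbound : ∀ n, -(1/2) ≤ d n ∧ d n ≤ 1/2)
    (hneg : ∀ n, d n < 0 → level (s n) ≥ 7/2)
    (hpos : ∀ n, d n > 0 → level (s n) ≤ 19/2)
    (h0 : 4 < level 0 ∧ level 0 < 9) :
    ∀ t ≥ (0 : ℝ), 3 ≤ level t ∧ level t ≤ 10 := by
  have step : ∀ n t, s n ≤ t → t ≤ s (n + 1) → (3 ≤ level (s n) ∧ level (s n) ≤ 10) →
      3 ≤ level t ∧ level t ≤ 10 := by
    intro n t h1 h2 ⟨h3, h4⟩
    rw [hlin n t h1 h2]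
    have hg := hgap n
    obtain ⟨hl, hu⟩ := hbound n
    have ha : 0 ≤ t - s n := by linarith
    have hb : t - s n ≤ 1 := by linarith
    rcases lt_trichotomy (d n) 0 with h | h | h
    · have := hneg n h
      constructor <;> nlinarith
    · rw [h]
      constructor <;> linarith
    · have := hpos n h
      constructor <;> nlinarith
  have inv : ∀ n, 3 ≤ level (s n) ∧ level (s n) ≤ 10 := by
    intro n
    induction n with
    | zero =>
      rw [hs0]
      constructor <;> linarith [h0.1, h0.2]
    | succ k ih => exact step k _ (hmono (Nat.lt_succ_self k)).le le_rfl ih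
  have cover : ∀ n t, 0 ≤ t → t ≤ s n → 3 ≤ level t ∧ level t ≤ 10 := by
    intro n
    induction n with
    | zero =>
      intro t h1 h2
      have : t = s 0 := by linarith
      rw [this]
      exact inv 0
    | succ k ih =>
      intro t h1 h2
      rcases le_total t (s k) with h | h
      · exact ih t h1 h
      · exact step k t h h2 (inv k)
  intro t ht
  obtain ⟨n, hn⟩ := (htend.eventually_ge_atTop t).exists
  exact cover n t ht hn
end
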